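/- Define g(μ) = −(−75 + 80μ + 72μ²)/((5 + 4μ)²·(3 + 4μ)) for μ ≥ 0. Then |g(μ)| ≤ 1 for all μ ≥ 0; moreover g(μ) > 0 for 0 ≤ μ < 5(√70 − 4)/36, g(5(√70 − 4)/36) = 0, and g(μ) < 0 for μ > 5(√70 − 4)/36, so the first positive zero of g is μ = 5(√70 − 4)/36 ≈ 0.6064, where g changes sign. -/

import Mathlib

open Set

noncomputable section

/-- Amplification factor at the grid-scale frequency `θ = π` of the implicit
scheme of SSP2(3,3,2) with the second-order three-point stencil. -/
def gSSP332threePt (μ : ℝ) : ℝ :=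
  -(-75 + 80 * μ + 72 * μ ^ 2) / ((5 + 4 * μ) ^ 2 * (3 + 4 * μ))

/-- With the root `r = 5(√70 − 4)/36`, the numerator of `g` factors over `ℝ`. -/
theorem gSSP332threePt_eq_factored (μ : ℝ) :
    gSSP332threePt μ =
      72 * (5 * (Real.sqrt 70 - 4) / 36 - μ) * (μ + 5 * (Real.sqrt 70 + 4) / 36) /
        ((5 + 4 * μ) ^ 2 * (3 + 4 * μ)) := by
  have hs : Real.sqrt 70 ^ 2 = 70 := Real.sq_sqrt (by norm_num)
  unfold gSSP332threePt
  congr 1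
  linear_combination -(25 / 18 : ℝ) * hs

/-- For `g(μ) = −(−75 + 80μ + 72μ²)/((5+4μ)²(3+4μ))`: `|g(μ)| ≤ 1` for all
`μ ≥ 0`; `g` is positive before, zero at, and negative after
`μ = 5(√70−4)/36 ≈ 0.6064`, which is its first positive zero, where it changes
sign. -/
theorem ssp332_threePt_amplification :
    (∀ μ : ℝ, 0 ≤ μ → |gSSP332threePt μ| ≤ 1) ∧
    (∀ μ : ℝ, 0 ≤ μ → μ < 5 * (Real.sqrt 70 - 4) / 36 → 0 < gSSP332threePt μ) ∧
    gSSP332threePt (5 * (Real.sqrt 70 - 4) / 36) = 0 ∧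
    (∀ μ : ℝ, 5 * (Real.sqrt 70 - 4) / 36 < μ → gSSP332threePt μ < 0) ∧
    5 * (Real.sqrt 70 - 4) / 36 ∈ Ioo (0.6064 : ℝ) 0.6065 := by
  have hroot : 5 * (Real.sqrt 70 - 4) / 36 ∈ Ioo (0.6064 : ℝ) 0.6065 := by
    have hlow : (8.3661 : ℝ) < Real.sqrt 70 := Real.lt_sqrt_of_sq_lt (by norm_num)
    have hupp : Real.sqrt 70 < (8.3667 : ℝ) := (Real.sqrt_lt' (by norm_num)).2 (by norm_num)
    constructor <;> linarith
  have hsqrt : 0 ≤ Real.sqrt 70 := Real.sqrt_nonneg 70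
  refine ⟨fun μ hμ => ?_, fun μ hμ hlt => ?_, ?_, fun μ hlt => ?_, hroot⟩
  · have hden : 0 < (5 + 4 * μ) ^ 2 * (3 + 4 * μ) := by positivity
    have hμ3 : 0 ≤ μ ^ 3 := by positivity
    rw [gSSP332threePt, abs_le, le_div_iff₀ hden, div_le_iff₀ hden]
    constructor <;> nlinarith
  · rw [gSSP332threePt_eq_factored]
    have hfactor : 0 < 5 * (Real.sqrt 70 - 4) / 36 - μ := sub_pos.2 hlt
    positivity
  · rw [gSSP332threePt_eq_factored, sub_self, mul_zero, zero_mul, zero_div]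
  · have hμ : 0 < μ := by linarith [hroot.1]
    rw [gSSP332threePt_eq_factored]
    refine div_neg_of_neg_of_pos (mul_neg_of_neg_of_pos ?_ (by positivity)) (by positivity)
    linarith
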